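/- arXiv:1910.02644 — 2 statements merged into one kernel-verified Lean document; each statement's English description precedes it below -/
import Mathlib

section
/- Let S = ⟨A ∣ u → v⟩ be a one-rule SRS over a finite alphabet A such that u is nonempty, u ≠ v, and v is bordered with u. Then there exist a finite alphabet Ã and a word ṽ ∈ Ã* such that, setting S̃ = ⟨Ã ∣ 1 → ṽ⟩, for every k ≥ 1 the graph M_k is embeddable in the reduction graph G_S if and only if M_k is embeddable in the reduction graph G_{S̃}. -/
/-- One-step reduction of the one-rule SRS `⟨A ∣ u → v⟩`: `w →_S w'`. -/
def Step {A : Type*} (u v w w' : List A) : Prop :=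
  ∃ p q : List A, w = p ++ u ++ q ∧ w' = p ++ v ++ q

/-- One-step reduction of `⟨A ∣ u → v⟩` carried out at position `i`. -/
def StepAt {A : Type*} (u v : List A) (i : ℕ) (w w' : List A) : Prop :=
  ∃ p q : List A, p.length = i ∧ w = p ++ u ++ q ∧ w' = p ++ v ++ q

/-- The diamond graph `M_k` is embeddable in the reduction graph `G_S` of
`S = ⟨A ∣ u → v⟩`: there are pairwise distinct words `x, y, z_1, …, z_k`
with `x →_S z_i` and `z_i →_S y` for every `i`. -/
def MkEmbeddable {A : Type*} (u v : List A) (k : ℕ) : Prop :=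
  ∃ (x y : List A) (z : Fin k → List A),
    Function.Injective z ∧ (∀ i, x ≠ z i) ∧ (∀ i, y ≠ z i) ∧ x ≠ y ∧
    ∀ i, Step u v x (z i) ∧ Step u v (z i) y

/-- Projection from the decorated alphabet `A ⊕ A` (`inl a` = plain letter `a`,
`inr a` = decorated letter `a•`) back to `A`. -/
def proj {A : Type*} : A ⊕ A → A := Sum.elim id id

/-- One-step reduction of the decorated SRS `S̄` carried out at position `i`:
some word `ū` projecting to `u` is replaced by the fully decorated `v•`. -/
def DecStepAt {A : Type*} (u v : List A) (i : ℕ) (w w' : List (A ⊕ A)) : Prop :=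
  ∃ p q ubar : List (A ⊕ A),
    p.length = i ∧ ubar.map proj = u ∧
    w = p ++ ubar ++ q ∧ w' = p ++ v.map Sum.inr ++ q

/-- The leftmost decorated letter of `w` is at position `i`. -/
def FirstDecorated {A : Type*} (w : List (A ⊕ A)) (i : ℕ) : Prop :=
  (∃ a : A, w[i]? = some (Sum.inr a)) ∧
  ∀ j < i, ∀ a : A, w[j]? ≠ some (Sum.inr a)

/-- The one-rule SRS `⟨A ∣ u → v⟩` is left cancellative:
`u, v` are nonempty and their first letters are distinct. -/
def LeftCancellative {A : Type*} (u v : List A) : Prop :=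
  u ≠ [] ∧ v ≠ [] ∧ u.head? ≠ v.head?

/-- `w` is bordered with `T`: `T` is both a prefix and a suffix of `w`. -/
def Bordered {A : Type*} (T w : List A) : Prop :=
  T <+: w ∧ T <:+ w

/-- `T` is self-overlap-free: `OVL(T) = ∅`, i.e. there is no nonempty `w`
with `T = x ++ w = w ++ y` for nonempty `x, y`. -/
def SelfOverlapFree {A : Type*} (T : List A) : Prop :=
  ∀ w x y : List A, w ≠ [] → x ≠ [] → y ≠ [] → T = x ++ w → T = w ++ y → False

/-- `glue T [R₁, …, R_k] = T R₁ T R₂ ⋯ T R_k T`, the word of `Bord_T` whose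
canonical decomposition is `R₁, …, R_k`; thus `φ_T (glue T Rs) = Rs`
(a word of length `Rs.length` over the alphabet `B` of `T`-free words). -/
def glue {A : Type*} (T : List A) : List (List A) → List A
  | [] => T
  | R :: Rs => T ++ R ++ glue T Rs

section helpers

def FF {A : Type} (T : List A) (Z : List {R : List A // ¬ T <:+: R}) : List A :=
  Z.flatMap (fun R => R.1 ++ T)

lemma FF_append {A : Type} (T : List A) (X Y : List {R : List A // ¬ T <:+: R}) :
    FF T (X ++ Y) = FF T X ++ FF T Y := by
  simp [FF]

lemma FF_cons {A : Type} (T : List A) (R : {R : List A // ¬ T <:+: R})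
    (Y : List {R : List A // ¬ T <:+: R}) :
    FF T (R :: Y) = R.1 ++ (T ++ FF T Y) := by
  simp [FF]

lemma FF_aux {A : Type} {T : List A} (hof : SelfOverlapFree T) {R R' s s' : List A}
    (hR' : ¬ T <:+: R') (hl : R.length ≤ R'.length)
    (h : R ++ (T ++ s) = R' ++ (T ++ s')) : R = R' := by
  have h1 : R <+: R' :=
    List.prefix_of_prefix_length_le (List.prefix_append R (T ++ s)) (h ▸ List.prefix_append _ _) hl
  obtain ⟨r, rfl⟩ := h1
  rw [List.append_assoc, List.append_cancel_left_eq] at h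
  by_cases hr : r = []
  · simp [hr]
  exfalso
  rcases le_total T.length r.length with h2 | h2
  · have h3 : T <+: r :=
      List.prefix_of_prefix_length_le (List.prefix_append T s) (h ▸ List.prefix_append _ _) h2
    exact hR' (h3.isInfix.trans (List.suffix_append R r).isInfix)
  · have h3 : r <+: T :=
      List.prefix_of_prefix_length_le (h ▸ List.prefix_append _ _) (List.prefix_append T s) h2
    obtain ⟨w, hw⟩ := h3
    by_cases hw0 : w = []
    · subst hw0
      simp at hw
      subst hw
      exact hR' (List.suffix_append R r).isInfix
    have h4 : w ++ s = T ++ s' := by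
      rw [← hw, List.append_assoc, List.append_cancel_left_eq] at h
      rw [h, hw]
    have hlen : T.length = r.length + w.length := by rw [← hw]; simp
    have hrl : 0 < r.length := List.length_pos_iff.mpr hr
    have h5 : w <+: T :=
      List.prefix_of_prefix_length_le (List.prefix_append w s) (h4 ▸ List.prefix_append _ _)
        (by omega)
    obtain ⟨y, hy⟩ := h5
    have hy0 : y ≠ [] := by
      rintro rfl
      simp at hy
      rw [hy] at hlen
      omega
    exact hof w r y hw0 hr hy0 hw.symm hy.symm

lemma FF_inj {A : Type} {T : List A} (hT : T ≠ []) (hof : SelfOverlapFree T) :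
    Function.Injective (FF T) := by
  intro X
  induction X with
  | nil =>
    intro Y h
    cases Y with
    | nil => rfl
    | cons R Y => rw [FF_cons] at h; simp [FF, hT] at h
  | cons R X ih =>
    intro Y h
    cases Y with
    | nil => rw [FF_cons] at h; simp [FF, hT] at h
    | cons R' Y =>
      rw [FF_cons, FF_cons] at h
      have hR : R.1 = R'.1 := by
        rcases le_total R.1.length R'.1.length with hl | hl
        · exact FF_aux hof R'.2 hl h
        · exact (FF_aux hof R.2 hl h.symm).symm
      rw [hR, List.append_cancel_left_eq, List.append_cancel_left_eq] at h
      rw [ih h, Subtype.ext hR]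

lemma FF_surj {A : Type} {T : List A} (hT : T ≠ []) :
    ∀ (n : ℕ) (w : List A), w.length ≤ n → ∃ Z, FF T Z = w ++ T := by
  have hTl : 0 < T.length := List.length_pos_iff.mpr hT
  intro n
  induction n with
  | zero =>
    intro w hw
    have : w = [] := by simpa using hw
    subst this
    exact ⟨[⟨[], by simpa using hT⟩], by simp [FF]⟩
  | succ n ih =>
    intro w hw
    by_cases h : T <:+: w
    · obtain ⟨a, b, rfl⟩ := h
      simp only [List.length_append] at hw
      obtain ⟨Z1, h1⟩ := ih a (by omega)
      obtain ⟨Z2, h2⟩ := ih b (by omega)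
      exact ⟨Z1 ++ Z2, by rw [FF_append, h1, h2]; simp⟩
    · exact ⟨[⟨w, h⟩], by simp [FF]⟩

lemma FF_surj' {A : Type} {T : List A} (hT : T ≠ []) (w : List A) : ∃ Z, FF T Z = w ++ T :=
  FF_surj hT _ w le_rfl

lemma FF_of_suffix {A : Type} {T : List A} (hT : T ≠ []) (hof : SelfOverlapFree T)
    {s : List A} (h : T <:+ T ++ s) : ∃ X, s = FF T X := by
  by_cases hs : s = []
  · exact ⟨[], by simp [hs, FF]⟩
  rcases le_total T.length s.length with hl | hl
  · have := List.suffix_of_suffix_length_le h (List.suffix_append T s) hl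
    obtain ⟨a, rfl⟩ := this
    obtain ⟨Z, hZ⟩ := FF_surj' hT a
    exact ⟨Z, hZ.symm⟩
  · have h1 := List.suffix_of_suffix_length_le (List.suffix_append T s) h hl
    obtain ⟨a, ha⟩ := h1
    obtain ⟨t, ht⟩ := h
    by_cases ha0 : a = []
    · subst ha0
      simp at ha
      subst ha
      obtain ⟨Z, hZ⟩ := FF_surj' hT []
      exact ⟨Z, by simpa using hZ.symm⟩
    · exfalso
      have h2 : t ++ a = T := by
        have : (t ++ a) ++ s = T ++ s := by rw [List.append_assoc, ha, ht]
        exact List.append_cancel_right this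
      have hsl : 0 < s.length := List.length_pos_iff.mpr hs
      have e1 := congrArg List.length ha
      have e2 := congrArg List.length h2
      have hal : 0 < a.length := List.length_pos_iff.mpr ha0
      simp only [List.length_append] at e1 e2
      refine hof a t s ha0 ?_ hs h2.symm ha.symm
      rintro rfl
      simp at e2
      omega

lemma FF_suffix {A : Type} (T : List A) (X : List {R : List A // ¬ T <:+: R}) :
    T <:+ T ++ FF T X := by
  induction X with
  | nil => simp [FF]
  | cons R X ih =>
    rw [FF_cons]
    exact ih.trans ((List.suffix_append R.1 _).trans (List.suffix_append T _))

lemma FF_len {A : Type} {T : List A} (hT : T ≠ []) (X : List {R : List A // ¬ T <:+: R}) :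
    X.length ≤ (FF T X).length := by
  have hTl : 0 < T.length := List.length_pos_iff.mpr hT
  induction X with
  | nil => simp
  | cons R X ih =>
    rw [FF_cons]
    simp only [List.length_append, List.length_cons]
    omega

lemma exists_T {A : Type} {u : List A} (hu : u ≠ []) :
    ∃ T : List A, T ≠ [] ∧ Bordered T u ∧ SelfOverlapFree T := by
  classical
  have hex : ∃ n : ℕ, ∃ T : List A, T.length = n ∧ T ≠ [] ∧ Bordered T u :=
    ⟨_, u, rfl, hu, List.prefix_refl u, List.suffix_refl u⟩
  obtain ⟨T, hl, hT, hb⟩ := Nat.find_spec hex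
  refine ⟨T, hT, hb, ?_⟩
  intro w x y hw hx hy h1 h2
  have hlt : w.length < Nat.find hex := by
    have hxl : 0 < x.length := List.length_pos_iff.mpr hx
    rw [← hl, h1, List.length_append]
    omega
  refine Nat.find_min hex hlt ⟨w, rfl, hw, ?_, ?_⟩
  · exact List.IsPrefix.trans ⟨y, h2.symm⟩ hb.1
  · exact List.IsSuffix.trans ⟨x, h1.symm⟩ hb.2

lemma Mk_map {A B : Type} {u v : List A} {u' v' : List B} (f : List A → List B)
    (k : ℕ) (hs : ∀ x z, Step u v x z → Step u' v' (f x) (f z))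
    (hf : Function.Injective f)
    (h : MkEmbeddable u v k) : MkEmbeddable u' v' k := by
  obtain ⟨x, y, z, hz, hx, hy, hxy, hh⟩ := h
  exact ⟨f x, f y, fun i => f (z i), fun i j e => hz (hf e), fun i e => hx i (hf e),
    fun i e => hy i (hf e), fun e => hxy (hf e), fun i => ⟨hs _ _ (hh i).1, hs _ _ (hh i).2⟩⟩

lemma reduce_step {A : Type} {u v : List A} (hu : u ≠ []) (huv : u ≠ v) (hb : Bordered u v) :
    ∃ (B : Type) (U V : List B), U.length < u.length ∧ U ≠ V ∧ Bordered U V ∧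
      ∀ k, MkEmbeddable u v k ↔ MkEmbeddable U V k := by
  obtain ⟨T, hT, hTu, hof⟩ := exists_T hu
  have hTl : 0 < T.length := List.length_pos_iff.mpr hT
  have hdec : ∀ w, Bordered T w → ∃ W, w = T ++ FF T W := by
    rintro w ⟨⟨s, rfl⟩, h2⟩
    obtain ⟨X, rfl⟩ := FF_of_suffix hT hof h2
    exact ⟨X, rfl⟩
  obtain ⟨U, hU⟩ := hdec u hTu
  obtain ⟨V, hV⟩ := hdec v ⟨hTu.1.trans hb.1, hTu.2.trans hb.2⟩
  refine ⟨_, U, V, ?_, ?_, ⟨?_, ?_⟩, ?_⟩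
  · have := FF_len hT U
    rw [hU, List.length_append]; omega
  · rintro rfl; exact huv (hU.trans hV.symm)
  · obtain ⟨x, hx⟩ := hb.1
    have h1 : T ++ x <:+ v := by
      obtain ⟨a, ha⟩ := hTu.2
      exact ⟨a, by rw [← hx, ← ha]; simp⟩
    have h2 : T <:+ T ++ x :=
      List.suffix_of_suffix_length_le (hTu.2.trans hb.2) h1 (by simp)
    obtain ⟨X, rfl⟩ := FF_of_suffix hT hof h2
    refine ⟨X, FF_inj hT hof ?_⟩
    rw [FF_append]
    apply List.append_cancel_left (as := T)
    rw [← hV, ← hx, hU]; simp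
  · obtain ⟨y, hy⟩ := hb.2
    have h1 : y ++ T <+: v := ⟨FF T U, by rw [← hy, hU]; simp⟩
    have h2 : T <+: y ++ T :=
      List.prefix_of_prefix_length_le (hTu.1.trans hb.1) h1 (by simp)
    obtain ⟨W, hW⟩ := hdec (y ++ T) ⟨h2, List.suffix_append _ _⟩
    refine ⟨W, FF_inj hT hof ?_⟩
    rw [FF_append]
    apply List.append_cancel_left (as := T)
    rw [← hV, ← hy, hU, ← List.append_assoc, ← hW]; simp
  · intro k
    constructor
    · choose g hg using FF_surj' (T := T) hT
      refine Mk_map g k ?_ ?_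
      · rintro x z ⟨p, q, rfl, rfl⟩
        refine ⟨g p, g q, FF_inj hT hof ?_, FF_inj hT hof ?_⟩
        · simp only [FF_append, hg, hU]; simp
        · simp only [FF_append, hg, hV]; simp
      · intro x y h
        have := congrArg (FF T) h
        rw [hg, hg] at this
        exact List.append_cancel_right this
    · refine Mk_map (fun X => T ++ FF T X) k ?_ ?_
      · rintro x z ⟨P, Q, rfl, rfl⟩
        obtain ⟨p, hp⟩ := FF_suffix T P
        refine ⟨p, FF T Q, ?_, ?_⟩
        · simp only [FF_append, hU]
          simp only [← List.append_assoc]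
          rw [hp]
        · simp only [FF_append, hV]
          simp only [← List.append_assoc]
          rw [hp]
      · intro X Y h
        exact FF_inj hT hof (List.append_cancel_left h)

lemma reduce_all : ∀ (n : ℕ) (A : Type) (u v : List A), u.length ≤ n → u ≠ v → Bordered u v →
    ∃ (B : Type) (V : List B), V ≠ [] ∧ ∀ k, MkEmbeddable u v k ↔ MkEmbeddable [] V k := by
  intro n
  induction n with
  | zero =>
    intro A u v hu huv hb
    have : u = [] := by simpa using hu
    subst this
    exact ⟨A, v, huv.symm, fun k => Iff.rfl⟩
  | succ n ih =>
    intro A u v hu huv hb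
    by_cases h0 : u = []
    · subst h0
      exact ⟨A, v, huv.symm, fun k => Iff.rfl⟩
    obtain ⟨B, U, V, hl, hne, hb', hk⟩ := reduce_step h0 huv hb
    obtain ⟨C, W, hW, hk'⟩ := ih B U V (by omega) hne hb'
    exact ⟨C, W, hW, fun k => (hk k).trans (hk' k)⟩

lemma comm_mem {A : Type} {v : List A} (hv : v ≠ []) :
    ∀ (n : ℕ) (r : List A), r.length ≤ n → v ++ r = r ++ v → ∀ a ∈ r, a ∈ v := by
  have hvl : 0 < v.length := List.length_pos_iff.mpr hv
  intro n
  induction n with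
  | zero =>
    intro r hr _ a ha
    have : r = [] := by simpa using hr
    simp [this] at ha
  | succ n ih =>
    intro r hr h a ha
    rcases le_total r.length v.length with hl | hl
    · have h1 : r <+: v :=
        List.prefix_of_prefix_length_le (h ▸ List.prefix_append _ _) (List.prefix_append v r) hl
      exact h1.subset ha
    · have h1 : v <+: r :=
        List.prefix_of_prefix_length_le (List.prefix_append v r) (h ▸ List.prefix_append _ _) hl
      obtain ⟨s, rfl⟩ := h1
      rw [List.append_assoc, List.append_cancel_left_eq] at h
      rcases List.mem_append.mp ha with ha | ha
      · exact ha
      · simp only [List.length_append] at hr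
        exact ih s (by omega) h a ha

lemma finite_red {B : Type} (V : List B) (hV : V ≠ []) :
    ∃ (Atil : Type) (_ : Fintype Atil) (vtil : List Atil),
      ∀ k : ℕ, 1 ≤ k → (MkEmbeddable ([] : List B) V k ↔ MkEmbeddable ([] : List Atil) vtil k) := by
  classical
  by_cases hc : ∃ c : B, c ∉ V
  swap
  · push Not at hc
    have : Fintype B := ⟨V.toFinset, fun b => by simpa using hc b⟩
    exact ⟨B, this, V, fun k _ => Iff.rfl⟩
  obtain ⟨c, hc⟩ := hc
  let f : B → Option {b : B // b ∈ V} := fun b => if h : b ∈ V then some ⟨b, h⟩ else none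
  let g : Option {b : B // b ∈ V} → B := fun o => o.elim c (fun b => b.1)
  have hf1 : ∀ a b, a ∈ V → f a = f b → a = b := by
    intro a b ha h
    by_cases hb : b ∈ V
    · simpa [f, ha, hb] using h
    · simp [f, ha, hb] at h
  have hg : Function.Injective g := by
    rintro (_ | a) (_ | b) h
    · rfl
    · have h' : c = b.1 := h
      exact absurd (h' ▸ b.2) hc
    · have h' : a.1 = c := h
      exact absurd (h' ▸ a.2) hc
    · simpa [g, Subtype.ext_iff] using h
  have hgf : (V.map f).map g = V := by
    rw [List.map_map]
    conv_rhs => rw [← List.map_id V]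
    apply List.map_congr_left
    intro a ha
    simp [f, g, ha]
  have hcomm : ∀ r, (V ++ r).map f = (r ++ V).map f → V ++ r = r ++ V := by
    intro r h
    have hm : ∀ a ∈ r, a ∈ V := by
      intro a ha
      have h1 := comm_mem (v := V.map f) (by simpa using hV) _ (r.map f) le_rfl
        (by simpa using h) (f a) (List.mem_map_of_mem ha)
      obtain ⟨b, hb, hab⟩ := List.mem_map.mp h1
      exact hf1 b a hb hab ▸ hb
    have h2 := congrArg (List.map g) h
    have hid : ∀ l : List B, (∀ a ∈ l, a ∈ V) → (l.map f).map g = l := by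
      intro l hl
      rw [List.map_map]
      conv_rhs => rw [← List.map_id l]
      apply List.map_congr_left
      intro a ha
      simp [f, g, hl a ha]
    rwa [hid, hid] at h2
    · intro a ha
      rcases List.mem_append.mp ha with h | h
      · exact hm a h
      · exact h
    · intro a ha
      rcases List.mem_append.mp ha with h | h
      · exact h
      · exact hm a h
  have hinj0 : ∀ p q p' q' : List B, p.length ≤ p'.length → p ++ q = p' ++ q' →
      (p ++ V ++ q).map f = (p' ++ V ++ q').map f → p ++ V ++ q = p' ++ V ++ q' := by
    intro p q p' q' hl h h2
    have h1 : p <+: p' :=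
      List.prefix_of_prefix_length_le (List.prefix_append p q) (h ▸ List.prefix_append _ _) hl
    obtain ⟨r, rfl⟩ := h1
    rw [List.append_assoc, List.append_cancel_left_eq] at h
    subst h
    have h3 : (V ++ r).map f = (r ++ V).map f := by
      have : p.map f ++ ((V ++ r).map f ++ q'.map f) = p.map f ++ ((r ++ V).map f ++ q'.map f) := by
        simpa using h2
      exact List.append_cancel_right (List.append_cancel_left this)
    have h4 := hcomm r h3
    calc p ++ V ++ (r ++ q') = p ++ (V ++ r) ++ q' := by simp
      _ = p ++ (r ++ V) ++ q' := by rw [h4]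
      _ = _ := by simp
  refine ⟨Option {b : B // b ∈ V}, inferInstance, V.map f, fun k hk => ⟨?_, ?_⟩⟩
  · rintro ⟨x, y, z, hz, hx, hy, hxy, hh⟩
    have hlen : ∀ a b : List B, Step [] V a b → b.length = a.length + V.length := by
      rintro a b ⟨p, q, rfl, rfl⟩
      simp; omega
    have hVl : 0 < V.length := List.length_pos_iff.mpr hV
    have hst : ∀ a b : List B, Step [] V a b → Step [] (V.map f) (a.map f) (b.map f) := by
      rintro a b ⟨p, q, rfl, rfl⟩
      exact ⟨p.map f, q.map f, by simp, by simp⟩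
    have hne : ∀ a b : List B, a.length ≠ b.length → a.map f ≠ b.map f := by
      intro a b h e
      apply h
      simpa using congrArg List.length e
    refine ⟨x.map f, y.map f, fun i => (z i).map f, ?_, ?_, ?_, ?_, ?_⟩
    · intro i j hij
      apply hz
      obtain ⟨p, q, e1, e2⟩ := (hh i).1
      obtain ⟨p', q', e1', e2'⟩ := (hh j).1
      simp only [List.append_nil] at e1 e1'
      simp only [e2, e2'] at hij ⊢
      rcases le_total p.length p'.length with hl | hl
      · exact hinj0 p q p' q' hl (e1.symm.trans e1') hij
      · exact (hinj0 p' q' p q hl (e1'.symm.trans e1) hij.symm).symm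
    · intro i
      have := hlen _ _ (hh i).1
      exact hne _ _ (by omega)
    · intro i
      have := hlen _ _ (hh i).2
      exact hne _ _ (by omega)
    · have h1 := hlen _ _ (hh ⟨0, hk⟩).1
      have h2 := hlen _ _ (hh ⟨0, hk⟩).2
      exact hne _ _ (by omega)
    · exact fun i => ⟨hst _ _ (hh i).1, hst _ _ (hh i).2⟩
  · refine Mk_map (List.map g) k ?_ (List.map_injective_iff.mpr hg)
    rintro a b ⟨p, q, rfl, rfl⟩
    exact ⟨p.map g, q.map g, by simp, by rw [List.map_append, List.map_append, hgf]⟩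

end helpers

/-- if `u` is nonempty, `u ≠ v` and `v` is bordered with `u`
(over a finite alphabet `A`), then there is a finite alphabet `Ã` and a word
`ṽ ∈ Ã*` such that for every `k ≥ 1`, `M_k` is embeddable in `G_S` iff it is
embeddable in `G_{S̃}` where `S̃ = ⟨Ã ∣ 1 → ṽ⟩`. -/
theorem full_reduction_bordered {A : Type} [Fintype A] (u v : List A)
    (hune : u ≠ []) (huv : u ≠ v) (hbord : Bordered u v) :
    ∃ (Atil : Type) (_ : Fintype Atil) (vtil : List Atil),
      ∀ k : ℕ, 1 ≤ k →
        (MkEmbeddable u v k ↔ MkEmbeddable ([] : List Atil) vtil k) := by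
  obtain ⟨B, V, hV, h⟩ := reduce_all _ A u v le_rfl huv hbord
  obtain ⟨C, iC, W, h'⟩ := finite_red V hV
  exact ⟨C, iC, W, fun k hk => (h k).trans (h' k hk)⟩
end

section
/- Let S = ⟨A ∣ u → v⟩ be a one-rule SRS over a finite alphabet A with u ≠ v and |A| ≥ 2. Then M_2 is embeddable in the reduction graph G_S, and exactly one of the following holds: either M_3 is not embeddable in G_S (so k = 2 is the maximal value for which M_k is embeddable in G_S), or M_k is embeddable in G_S for every natural number k ≥ 1. -/
section helpers
variable {A : Type*}

lemma step_swap {u v w w' : List A} (h : Step u v w w') : Step v u w' w := by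
  obtain ⟨p, q, h1, h2⟩ := h
  exact ⟨p, q, h2, h1⟩

lemma mk_swap {u v : List A} {k : ℕ} (h : MkEmbeddable u v k) : MkEmbeddable v u k := by
  obtain ⟨x, y, z, h1, h2, h3, h4, h5⟩ := h
  exact ⟨y, x, z, h1, h3, h2, h4.symm, fun i => ⟨step_swap (h5 i).2, step_swap (h5 i).1⟩⟩

lemma step_rev {u v w w' : List A} (h : Step u v w w') :
    Step u.reverse v.reverse w.reverse w'.reverse := by
  obtain ⟨p, q, h1, h2⟩ := h
  exact ⟨q.reverse, p.reverse, by simp [h1], by simp [h2]⟩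

lemma mk_rev {u v : List A} {k : ℕ} (h : MkEmbeddable u v k) :
    MkEmbeddable u.reverse v.reverse k := by
  obtain ⟨x, y, z, h1, h2, h3, h4, h5⟩ := h
  refine ⟨x.reverse, y.reverse, fun i => (z i).reverse, ?_, ?_, ?_, ?_, ?_⟩
  · intro i j hij
    exact h1 (List.reverse_injective hij)
  · intro i hi
    exact h2 i (List.reverse_injective hi)
  · intro i hi
    exact h3 i (List.reverse_injective hi)
  · intro hi
    exact h4 (List.reverse_injective hi)
  · intro i
    exact ⟨step_rev (h5 i).1, step_rev (h5 i).2⟩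

lemma m2_le (hA : ∀ a : A, ∃ b, b ≠ a) (u v : List A) (huv : u ≠ v)
    (hl : u.length ≤ v.length) : MkEmbeddable u v 2 := by
  have key : ∃ t : List A, v ++ t ++ u ≠ u ++ t ++ v := by
    rcases Nat.lt_or_ge u.length v.length with h | h
    · obtain ⟨c, hc⟩ := hA (v[u.length])
      refine ⟨[c], fun e => hc ?_⟩
      have := congrArg (fun l => l[u.length]?) e
      simp [List.getElem?_append, h] at this
      exact this.symm
    · refine ⟨[], fun e => huv ?_⟩
      simp only [List.append_nil] at e
      exact (List.append_inj e (by omega)).1.symm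
  obtain ⟨t, ht⟩ := key
  refine ⟨u ++ t ++ u, v ++ t ++ v, ![v ++ t ++ u, u ++ t ++ v], ?_, ?_, ?_, ?_, ?_⟩
  · intro i j hij
    fin_cases i <;> fin_cases j <;> simp_all
  · intro i
    fin_cases i <;> simp [huv]
  · intro i
    fin_cases i <;> simp [huv.symm]
  · intro e
    have hl := congrArg List.length e
    simp only [List.length_append] at hl
    have := List.append_inj (List.append_inj e (by simp; omega)).1 (by omega)
    exact huv this.1
  · intro i
    fin_cases i
    · exact ⟨⟨[], t ++ u, by simp, by simp⟩, ⟨v ++ t, [], by simp, by simp⟩⟩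
    · exact ⟨⟨u ++ t, [], by simp, by simp⟩, ⟨[], t ++ v, by simp, by simp⟩⟩

lemma m2_all (hA : ∀ a : A, ∃ b, b ≠ a) (u v : List A) (huv : u ≠ v) :
    MkEmbeddable u v 2 := by
  rcases Nat.le_total u.length v.length with h | h
  · exact m2_le hA u v huv h
  · exact mk_swap (m2_le hA v u huv.symm h)

lemma no_three {u v : List A} (E : List A → List A → List A → Prop)
    (huniq : ∀ x y g1 g2, E x y g1 → E x y g2 → g1 = g2)
    (hex : ∀ x y z, Step u v x z → Step u v z y → ∃ g, E x y g ∧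
      ((∃ b, x = g ++ u ++ b ∧ z = g ++ v ++ b) ∨ (∃ d, z = g ++ u ++ d ∧ y = g ++ v ++ d))) :
    ¬ MkEmbeddable u v 3 := by
  rintro ⟨x, y, z, hz, -, -, -, h⟩
  have h' := fun i => hex x y (z i) (h i).1 (h i).2
  choose g hg1 hg2 using h'
  have hg : ∀ i, g i = g 0 := fun i => huniq x y _ _ (hg1 i) (hg1 0)
  have hL : ∀ i j, (∃ b, x = g i ++ u ++ b ∧ z i = g i ++ v ++ b) →
      (∃ b, x = g j ++ u ++ b ∧ z j = g j ++ v ++ b) → i = j := by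
    rintro i j ⟨b, h1, h2⟩ ⟨b', h3, h4⟩
    rw [hg i] at h1 h2
    rw [hg j] at h3 h4
    apply hz
    rw [h1] at h3
    have := List.append_cancel_left h3
    rw [h2, h4, this]
  have hR : ∀ i j, (∃ d, z i = g i ++ u ++ d ∧ y = g i ++ v ++ d) →
      (∃ d, z j = g j ++ u ++ d ∧ y = g j ++ v ++ d) → i = j := by
    rintro i j ⟨b, h2, h1⟩ ⟨b', h4, h3⟩
    rw [hg i] at h1 h2
    rw [hg j] at h3 h4
    apply hz
    rw [h1] at h3
    have := List.append_cancel_left h3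
    rw [h2, h4, this]
  have n01 : (0 : Fin 3) ≠ 1 := by decide
  have n02 : (0 : Fin 3) ≠ 2 := by decide
  have n12 : (1 : Fin 3) ≠ 2 := by decide
  rcases hg2 0 with h0 | h0 <;> rcases hg2 1 with h1 | h1 <;> rcases hg2 2 with h2 | h2
  · exact n01 (hL _ _ h0 h1)
  · exact n01 (hL _ _ h0 h1)
  · exact n02 (hL _ _ h0 h2)
  · exact n12 (hR _ _ h1 h2)
  · exact n12 (hL _ _ h1 h2)
  · exact n02 (hR _ _ h0 h2)
  · exact n01 (hR _ _ h0 h1)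
  · exact n01 (hR _ _ h0 h1)

lemma incomparable : ∀ (u v : List A), ¬ u <+: v → ¬ v <+: u →
    ∃ (α : List A) (a b : A) (u' v' : List A), a ≠ b ∧ u = α ++ [a] ++ u' ∧ v = α ++ [b] ++ v'
  | [], v, h, _ => absurd (List.nil_prefix) h
  | _ :: _, [], _, h => absurd (List.nil_prefix) h
  | a :: u, b :: v, h1, h2 => by
    by_cases hab : a = b
    · subst hab
      rw [List.prefix_cons_inj] at h1 h2
      obtain ⟨α, c, d, u', v', h, rfl, rfl⟩ := incomparable u v h1 h2
      exact ⟨a :: α, c, d, u', v', h, by simp, by simp⟩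
    · exact ⟨[], a, b, u, v, hab, by simp, by simp⟩

lemma pre_of {p q x : List A} (h1 : p <+: x) (h2 : q <+: x) (h : p.length ≤ q.length) :
    p <+: q := List.prefix_of_prefix_length_le h1 h2 h

lemma no3_incomp {u v : List A} (h1 : ¬ u <+: v) (h2 : ¬ v <+: u) : ¬ MkEmbeddable u v 3 := by
  obtain ⟨α, a0, b0, u', v', hab, hu, hv⟩ := incomparable u v h1 h2
  apply no_three (fun x y g => g ++ (α ++ [a0]) <+: x ∧ g ++ (α ++ [b0]) <+: y)
  · have key : ∀ x y g1 g2 : List A, (g1 ++ (α ++ [a0]) <+: x ∧ g1 ++ (α ++ [b0]) <+: y) →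
        (g2 ++ (α ++ [a0]) <+: x ∧ g2 ++ (α ++ [b0]) <+: y) → ¬ g1.length < g2.length := by
      rintro x y g1 g2 ⟨a1, a2⟩ ⟨a3, a4⟩ hlt
      have e1 : g2 ++ α <+: x := by
        refine List.IsPrefix.trans ⟨[a0], ?_⟩ a3
        simp
      have e2 : g2 ++ α <+: y := by
        refine List.IsPrefix.trans ⟨[b0], ?_⟩ a4
        simp
      have e3 := pre_of a1 e1 (by simp; omega)
      have e4 := pre_of a2 e2 (by simp; omega)
      have e5 := pre_of e3 e4 (by simp)
      have e6 := e5.eq_of_length (by simp)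
      simp at e6
      exact hab e6
    intro x y g1 g2 k1 k2
    have l1 := key x y g1 g2 k1 k2
    have l2 := key x y g2 g1 k2 k1
    have e1 : g1 <+: x := List.IsPrefix.trans ⟨_, rfl⟩ k1.1
    have e2 : g2 <+: x := List.IsPrefix.trans ⟨_, rfl⟩ k2.1
    exact (pre_of e1 e2 (by omega)).eq_of_length (by omega)
  · rintro x y z ⟨a, b, hx, hz⟩ ⟨c, d, hz', hy⟩
    have xa : a ++ (α ++ [a0]) <+: x := ⟨u' ++ b, by simp [hx, hu]⟩
    have xa' : a ++ α <+: x := List.IsPrefix.trans ⟨[a0], by simp⟩ xa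
    have za : a ++ (α ++ [b0]) <+: z := ⟨v' ++ b, by simp [hz, hv]⟩
    have za' : a ++ α <+: z := List.IsPrefix.trans ⟨[b0], by simp⟩ za
    have zc : c ++ (α ++ [a0]) <+: z := ⟨u' ++ d, by simp [hz', hu]⟩
    have zc' : c ++ α <+: z := List.IsPrefix.trans ⟨[a0], by simp⟩ zc
    have yc : c ++ (α ++ [b0]) <+: y := ⟨v' ++ d, by simp [hy, hv]⟩
    have yc' : c ++ α <+: y := List.IsPrefix.trans ⟨[b0], by simp⟩ yc
    rcases Nat.lt_trichotomy a.length c.length with h | h | h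
    · exact ⟨a, ⟨xa, (pre_of za zc' (by simp; omega)).trans yc'⟩, Or.inl ⟨b, hx, hz⟩⟩
    · have : a = c := (pre_of (List.IsPrefix.trans ⟨_, rfl⟩ za')
        (List.IsPrefix.trans ⟨_, rfl⟩ zc') h.le).eq_of_length h
      subst this
      exact ⟨a, ⟨xa, yc⟩, Or.inl ⟨b, hx, hz⟩⟩
    · exact ⟨c, ⟨(pre_of zc za' (by simp; omega)).trans xa', yc⟩, Or.inr ⟨d, hz', hy⟩⟩

/-- power of a word -/
def rp (r : List A) : ℕ → List A
  | 0 => []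
  | n + 1 => r ++ rp r n

lemma rp_add (r : List A) (m n : ℕ) : rp r (m + n) = rp r m ++ rp r n := by
  induction m with
  | zero => simp [rp]
  | succ m ih => rw [Nat.succ_add, rp, rp, ih, List.append_assoc]

lemma rp_succ' (r : List A) (n : ℕ) : rp r (n + 1) = rp r n ++ r := by
  rw [rp_add]; simp [rp]

lemma rp_len (r : List A) (n : ℕ) : (rp r n).length = n * r.length := by
  induction n with
  | zero => simp [rp]
  | succ n ih => simp [rp, ih]; ring

lemma rp_pre {r u : List A} (h : u <+: r ++ u) (n : ℕ) : u <+: rp r n ++ u := by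
  induction n with
  | zero => simp [rp]
  | succ n ih =>
    rw [rp, List.append_assoc]
    exact h.trans ((List.prefix_append_right_inj r).2 ih)

lemma rp_mono {r u : List A} (h : u <+: r ++ u) {m n : ℕ} (hmn : m ≤ n) :
    rp r m ++ u <+: rp r n ++ u := by
  obtain ⟨k, rfl⟩ := Nat.exists_eq_add_of_le hmn
  rw [rp_add, List.append_assoc]
  exact (List.prefix_append_right_inj _).2 (rp_pre h k)

/-- the bad case -/
lemma no3_aligned {u v r : List A} {m : ℕ} (hm : 1 ≤ m) (hr : r ≠ [])
    (hv : v = rp r m ++ u) (hru : u <+: r ++ u)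
    (hal : ∀ N k, k ++ u <+: rp r N ++ u → ∃ j, k = rp r j) : ¬ MkEmbeddable u v 3 := by
  have hrl : 0 < r.length := List.length_pos_iff.2 hr
  -- maximal exponent
  have hmax : ∀ g x : List A, g ++ u <+: x → ∃ N, g ++ (rp r N ++ u) <+: x ∧
      ¬ g ++ (rp r (N + 1) ++ u) <+: x := by
    intro g x h
    by_contra! hcon
    have : ∀ N, g ++ (rp r N ++ u) <+: x := by
      intro N
      induction N with
      | zero => simpa [rp] using h
      | succ N ih => exact hcon N ih
    have h1 := (this (x.length + 1)).length_le
    simp only [List.length_append, rp_len] at h1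
    nlinarith
  -- if `g`, `g'` not ending in r, alignment
  have hsep : ∀ g g' x : List A, ∀ N, g ++ (rp r N ++ u) <+: x → g' ++ u <+: x →
      ¬ r <:+ g' → g.length < g'.length → g ++ (rp r N ++ u) <+: g' ++ u := by
    intro g g' x N h1 h2 h3 h4
    rcases Nat.le_total (g ++ (rp r N ++ u)).length (g' ++ u).length with h | h
    · exact pre_of h1 h2 h
    · exfalso
      have e1 := pre_of h2 h1 h
      have e2 : g <+: g' := pre_of (List.IsPrefix.trans ⟨_, rfl⟩ h1)
        (List.IsPrefix.trans ⟨_, rfl⟩ h2) h4.le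
      obtain ⟨k, rfl⟩ := e2
      rw [List.append_assoc, List.prefix_append_right_inj] at e1
      obtain ⟨j, rfl⟩ := hal _ _ e1
      rcases j with _ | j
      · simp [rp] at h4
      · apply h3
        rw [rp_succ', ← List.append_assoc]
        exact ⟨_, rfl⟩
  have hnorm : ∀ n : ℕ, ∀ a b x z : List A, a.length ≤ n → x = a ++ u ++ b → z = a ++ v ++ b →
      ∃ a b, x = a ++ u ++ b ∧ z = a ++ v ++ b ∧ ¬ r <:+ a := by
    intro n
    induction n with
    | zero =>
      intro a b x z hn hx hz
      refine ⟨a, b, hx, hz, fun h => ?_⟩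
      have := h.length_le
      omega
    | succ n ih =>
      intro a b x z hn hx hz
      by_cases h : r <:+ a
      · obtain ⟨a', rfl⟩ := h
        obtain ⟨t, ht⟩ := hru
        refine ih a' (t ++ b) x z (by simp at hn; omega) ?_ ?_
        · rw [hx]
          simp only [List.append_assoc]
          rw [← List.append_assoc r u b, ← ht]
          simp
        · rw [hz, hv]
          have : r ++ rp r m = rp r m ++ r := by rw [← rp_succ', rp]
          calc a' ++ r ++ (rp r m ++ u) ++ b = a' ++ (r ++ rp r m) ++ u ++ b := by simp
            _ = a' ++ rp r m ++ (r ++ u) ++ b := by rw [this]; simp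
            _ = _ := by rw [← ht]; simp
      · exact ⟨a, b, hx, hz, h⟩
  -- growth
  have hgrow : ∀ a b : List A, ∀ N, a ++ (rp r N ++ u) <+: a ++ u ++ b →
      a ++ (rp r (m + N) ++ u) <+: a ++ v ++ b := by
    intro a b N h
    rw [List.append_assoc, List.prefix_append_right_inj] at h
    rw [hv, rp_add]
    simp only [List.append_assoc]
    rw [List.prefix_append_right_inj, List.prefix_append_right_inj]
    exact h
  apply no_three (fun x y g => ¬ r <:+ g ∧ ∃ N, g ++ (rp r N ++ u) <+: x ∧
      ¬ g ++ (rp r (N + 1) ++ u) <+: x ∧ g ++ (rp r (N + 1) ++ u) <+: y)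
  · have hu0 : ∀ g x : List A, ∀ N, g ++ (rp r N ++ u) <+: x → g ++ u <+: x := by
      intro g x N h
      exact ((List.prefix_append_right_inj g).2 (rp_pre hru N)).trans h
    have key : ∀ x y g1 g2 : List A, (¬ r <:+ g1 ∧ ∃ N, g1 ++ (rp r N ++ u) <+: x ∧
        ¬ g1 ++ (rp r (N + 1) ++ u) <+: x ∧ g1 ++ (rp r (N + 1) ++ u) <+: y) →
        (¬ r <:+ g2 ∧ ∃ N, g2 ++ (rp r N ++ u) <+: x ∧
        ¬ g2 ++ (rp r (N + 1) ++ u) <+: x ∧ g2 ++ (rp r (N + 1) ++ u) <+: y) →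
        ¬ g1.length < g2.length := by
      rintro x y g1 g2 ⟨_, N, _, b1, c1⟩ ⟨a, M, a2, _, c2⟩ hlt
      exact b1 ((hsep g1 g2 y _ c1 (hu0 _ _ _ c2) a hlt).trans (hu0 _ _ _ a2))
    intro x y g1 g2 k1 k2
    have l1 := key x y g1 g2 k1 k2
    have l2 := key x y g2 g1 k2 k1
    obtain ⟨_, _, p1, _⟩ := k1
    obtain ⟨_, _, p2, _⟩ := k2
    have e1 : g1 <+: x := List.IsPrefix.trans ⟨_, rfl⟩ p1
    have e2 : g2 <+: x := List.IsPrefix.trans ⟨_, rfl⟩ p2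
    exact (pre_of e1 e2 (by omega)).eq_of_length (by omega)
  · rintro x y z ⟨a0, b0, hx0, hz0⟩ ⟨c0, d0, hz0', hy0⟩
    obtain ⟨a, b, hx, hz, ha⟩ := hnorm _ a0 b0 x z le_rfl hx0 hz0
    obtain ⟨c, d, hz', hy, hc⟩ := hnorm _ c0 d0 z y le_rfl hz0' hy0
    have xa : a ++ u <+: x := ⟨b, hx.symm⟩
    have zc : c ++ u <+: z := ⟨d, hz'.symm⟩
    have hg0 : ∀ g b : List A, g ++ u <+: g ++ v ++ b := by
      intro g b
      rw [List.append_assoc, List.prefix_append_right_inj, hv]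
      exact (rp_pre hru m).trans ⟨_, rfl⟩
    have za : a ++ u <+: z := hz ▸ hg0 a b
    have yc : c ++ u <+: y := hy ▸ hg0 c d
    have hshrink : ∀ g w : List A, ∀ N M, N ≤ M → g ++ (rp r M ++ u) <+: w →
        g ++ (rp r N ++ u) <+: w := by
      intro g w N M h h'
      exact ((List.prefix_append_right_inj g).2 (rp_mono hru h)).trans h'
    rcases Nat.lt_trichotomy a.length c.length with h | h | h
    · obtain ⟨N, n1, n2⟩ := hmax a x xa
      have n3 : a ++ (rp r (m + N) ++ u) <+: z := by
        rw [hz]; exact hgrow _ _ _ (hx ▸ n1)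
      have n4 := (hsep a c z _ n3 zc hc h).trans yc
      exact ⟨a, ⟨ha, N, n1, n2, hshrink _ _ _ _ (by omega) n4⟩, Or.inl ⟨b, hx, hz⟩⟩
    · have : a = c := (pre_of (List.IsPrefix.trans ⟨_, rfl⟩ za)
        (List.IsPrefix.trans ⟨_, rfl⟩ zc) h.le).eq_of_length h
      subst this
      obtain ⟨N, n1, n2⟩ := hmax a x xa
      have n3 : a ++ (rp r (m + N) ++ u) <+: z := by
        rw [hz]; exact hgrow _ _ _ (hx ▸ n1)
      have n4 : a ++ (rp r (m + (m + N)) ++ u) <+: y := by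
        rw [hy]; exact hgrow _ _ _ (hz' ▸ n3)
      exact ⟨a, ⟨ha, N, n1, n2, hshrink _ _ _ _ (by omega) n4⟩, Or.inl ⟨b, hx, hz⟩⟩
    · have xc : c ++ u <+: x := (pre_of zc za (by simp; omega)).trans xa
      obtain ⟨N, n1, n2⟩ := hmax c x xc
      have n3 : c ++ (rp r N ++ u) <+: z := (hsep c a x _ n1 xa ha h).trans za
      have n4 : c ++ (rp r (m + N) ++ u) <+: y := by
        rw [hy]; exact hgrow _ _ _ (hz' ▸ n3)
      exact ⟨c, ⟨hc, N, n1, n2, hshrink _ _ _ _ (by omega) n4⟩, Or.inr ⟨d, hz', hy⟩⟩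

/-- the good case -/
lemma all_k {u v w s t : List A} (hw : v = w ++ u) (hpre : u <+: v) (hst : v = s ++ u ++ t)
    (hne : s ++ w ≠ w ++ s) (k : ℕ) : MkEmbeddable u v k := by
  have hsw : s <+: w := by
    refine pre_of (x := v) ⟨u ++ t, by simp [hst]⟩ ⟨u, hw.symm⟩ ?_
    have := congrArg List.length (hw.symm.trans hst)
    simp at this
    omega
  obtain ⟨t', rfl⟩ := hsw
  have htu : t' ++ u = u ++ t := by
    have := hw.symm.trans hst
    simpa using this
  obtain ⟨w2, hw2⟩ := hpre
  set τ := s ++ (s ++ t') ++ t' with hτ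
  have hsu : u <+: s ++ u := by
    refine pre_of (x := v) ⟨w2, hw2⟩ ⟨t, hst.symm⟩ (by simp)
  have hτu : u <+: τ ++ u := by
    have : τ ++ u = s ++ u ++ (w2 ++ t) := by
      calc τ ++ u = s ++ (s ++ t') ++ (t' ++ u) := by simp [hτ]
        _ = s ++ ((s ++ t') ++ u) ++ t := by rw [htu]; simp
        _ = _ := by rw [← hw, ← hw2]; simp
    rw [this]
    exact hsu.trans ⟨_, rfl⟩
  have hnw : 0 < (s ++ t').length := by
    rw [List.length_pos_iff]
    intro h
    simp at h
    simp [h] at hne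
  have hlen : ∀ p, p < k → (rp τ p).length + (rp τ (k - p)).length = k * τ.length := by
    intro p hp
    rw [rp_len, rp_len, ← add_mul]
    congr 1
    omega
  have hτl : τ.length = (s ++ t').length + (s ++ t').length := by
    simp [hτ]; omega
  have key : ∀ p q : ℕ, p < q → q < k →
      rp τ p ++ (s ++ t') ++ rp τ (k - p) ++ u ≠ rp τ q ++ (s ++ t') ++ rp τ (k - q) ++ u := by
    intro p q hpq hqk h
    obtain ⟨j, rfl⟩ := Nat.exists_eq_add_of_lt hpq
    obtain ⟨l, hl⟩ : ∃ l, k - p = l + 1 := ⟨k - p - 1, by omega⟩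
    rw [hl, show p + j + 1 = p + (j + 1) by omega, rp_add τ p] at h
    simp only [rp, List.append_assoc, List.append_cancel_left_eq, hτ] at h
    rw [← List.append_assoc t' s, ← List.append_assoc s t'
      (t' ++ (rp (s ++ (s ++ (t' ++ t'))) j ++ _))] at h
    have := (List.append_inj h (by simp; omega)).1
    apply hne
    simp [this]
  refine ⟨rp τ k ++ u, rp τ (k + 1) ++ u,
    fun i => rp τ i ++ (s ++ t') ++ rp τ (k - i) ++ u, ?_, ?_, ?_, ?_, ?_⟩
  · intro i j hij
    simp only at hij
    rcases Nat.lt_trichotomy i.1 j.1 with h | h | h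
    · exact absurd hij (key _ _ h j.2)
    · exact Fin.ext h
    · exact absurd hij.symm (key _ _ h i.2)
  · intro i h
    have := congrArg List.length h
    have h2 := hlen i i.2
    rw [List.length_append, List.length_append, List.length_append, List.length_append,
      rp_len τ k] at this
    omega
  · intro i h
    have := congrArg List.length h
    have h2 := hlen i i.2
    rw [List.length_append, List.length_append, List.length_append, List.length_append,
      rp_len τ (k + 1), add_mul] at this
    omega
  · intro h
    have := congrArg List.length h
    rw [List.length_append, List.length_append, rp_len τ (k + 1), rp_len τ k, add_mul] at this
    omega
  · intro i
    obtain ⟨β, hβ⟩ := rp_pre hτu (k - i)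
    have hk : k = i + (k - i) := by omega
    constructor
    · refine ⟨rp τ i, β, ?_, ?_⟩
      · conv_lhs => rw [hk, rp_add]
        rw [List.append_assoc, ← hβ]; simp
      · beta_reduce
        rw [List.append_assoc, ← hβ, hw]; simp
    · refine ⟨rp τ i ++ s, t ++ β, ?_, ?_⟩
      · beta_reduce
        rw [List.append_assoc, ← hβ]
        calc rp τ i ++ (s ++ t') ++ (u ++ β) = rp τ i ++ s ++ (t' ++ u) ++ β := by simp
          _ = _ := by rw [htu]; simp
      · conv_lhs => rw [hk, add_assoc, rp_add, add_comm (k - (i : ℕ)) 1, rp_add]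
        simp only [List.append_assoc]
        rw [← hβ]
        have : rp τ 1 ++ (u ++ β) = s ++ (v ++ (t ++ β)) := by
          calc rp τ 1 ++ (u ++ β) = s ++ (s ++ t') ++ (t' ++ u) ++ β := by simp [rp, hτ]
            _ = s ++ ((s ++ t') ++ u) ++ t ++ β := by rw [htu]; simp
            _ = _ := by rw [← hw]; simp
        rw [this]

lemma comm_rp {k w : List A} (h : k ++ w = w ++ k) (n : ℕ) : k ++ rp w n = rp w n ++ k := by
  induction n with
  | zero => simp [rp]
  | succ n ih =>
    rw [rp, ← List.append_assoc, h, List.append_assoc, ih, List.append_assoc]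

lemma root_exists (w : List A) (hw : w ≠ []) :
    ∃ r : List A, r ≠ [] ∧ ∀ k, k ++ w = w ++ k → ∃ j, k = rp r j := by
  classical
  have hex : ∃ n, ∃ r : List A, r.length = n ∧ r ≠ [] ∧ r ++ w = w ++ r := ⟨_, w, rfl, hw, rfl⟩
  obtain ⟨r, hrl, hr, hrw⟩ := Nat.find_spec hex
  have hmin : ∀ k : List A, k ≠ [] → k ++ w = w ++ k → r.length ≤ k.length := by
    intro k hk hkw
    rw [hrl]
    exact Nat.find_min' hex ⟨k, rfl, hk, hkw⟩
  refine ⟨r, hr, ?_⟩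
  have hwl : 0 < w.length := List.length_pos_iff.2 hw
  have hrl : 0 < r.length := List.length_pos_iff.2 hr
  have main : ∀ n, ∀ k : List A, k.length ≤ n → k ++ w = w ++ k → ∃ j, k = rp r j := by
    intro n
    induction n with
    | zero =>
      intro k hk _
      exact ⟨0, by simpa [rp] using hk⟩
    | succ n ih =>
      intro k hk hkw
      by_cases hk0 : k = []
      · exact ⟨0, by simpa [rp] using hk0⟩
      have hle := hmin k hk0 hkw
      have hp : ∀ q : List A, q ++ w = w ++ q → q.length ≤ k.length → q <+: rp w k.length := by
        intro q hq hl
        refine pre_of (x := q ++ rp w k.length) ⟨_, rfl⟩ ⟨q, (comm_rp hq _).symm⟩ ?_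
        rw [rp_len]
        nlinarith
      obtain ⟨k', rfl⟩ := pre_of (hp r hrw hle) (hp k hkw le_rfl) hle
      have : k' ++ w = w ++ k' := by
        rw [← List.append_assoc, ← hrw, List.append_assoc, List.append_assoc] at hkw
        exact List.append_cancel_left hkw
      obtain ⟨j, rfl⟩ := ih k' (by simp at hk; omega) this
      exact ⟨j + 1, rfl⟩
  intro k hk
  exact main _ k le_rfl hk

lemma dich_bordered {u v : List A} (huv : u ≠ v) (hp : u <+: v) (hs : u <:+ v)
    (h3 : MkEmbeddable u v 3) (k : ℕ) : MkEmbeddable u v k := by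
  obtain ⟨w, hw⟩ := hs
  have hw0 : w ≠ [] := by
    rintro rfl
    exact huv (by simpa using hw)
  by_cases hgood : ∃ s t, v = s ++ u ++ t ∧ s ++ w ≠ w ++ s
  · obtain ⟨s, t, hst, hne⟩ := hgood
    exact all_k hw.symm hp hst hne k
  · exfalso
    push Not at hgood
    obtain ⟨r, hr, hroot⟩ := root_exists w hw0
    obtain ⟨m, hm⟩ := hroot w rfl
    have hm1 : 1 ≤ m := by
      rcases m with _ | m
      · exact absurd hm hw0
      · omega
    have hv : v = rp r m ++ u := by rw [← hm, hw]
    have hrl : 0 < r.length := List.length_pos_iff.2 hr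
    have hrv : r <+: v := by
      obtain ⟨n, rfl⟩ : ∃ n, m = n + 1 := ⟨m - 1, by omega⟩
      rw [hv, rp, List.append_assoc]
      exact ⟨_, rfl⟩
    have hru : u <+: r ++ u := by
      have huw : u <+: w ++ u := hw.symm ▸ hp
      have hrw : r ++ w = w ++ r := by rw [hm, ← rp_succ', rp]
      have hwl : 0 < w.length := List.length_pos_iff.2 hw0
      have e1 : u <+: rp w u.length := by
        refine pre_of (rp_pre huw u.length) ⟨_, rfl⟩ ?_
        rw [rp_len]
        nlinarith
      have e2 : r ++ u <+: r ++ rp w u.length := (List.prefix_append_right_inj _).2 e1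
      rw [comm_rp hrw] at e2
      exact pre_of (e1.trans ⟨_, rfl⟩) e2 (by simp)
    have hal : ∀ L N, ∀ k : List A, k.length ≤ L → k ++ u <+: rp r N ++ u →
        ∃ j, k = rp r j := by
      intro L
      induction L with
      | zero =>
        intro N k hk _
        exact ⟨0, by simpa [rp] using hk⟩
      | succ L ih =>
        intro N k hk hkN
        by_cases hk0 : k = []
        · exact ⟨0, by simpa [rp] using hk0⟩
        have hN : 1 ≤ N := by
          rcases N with _ | N
          · have h1 := hkN.length_le
            have := List.length_pos_iff.2 hk0
            simp [rp] at h1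
            exact absurd h1 hk0
          · omega
        rcases Nat.lt_or_ge k.length r.length with hlt | hge
        · have e1 : rp r 1 ++ u <+: rp r N ++ u := rp_mono hru hN
          have e2 : k ++ u <+: rp r 1 ++ u := pre_of hkN e1 (by simp [rp]; omega)
          have e3 : k ++ u <+: v := hv ▸ e2.trans (rp_mono hru hm1)
          obtain ⟨t, ht⟩ := e3
          exact hroot k (hgood k t ht.symm)
        · obtain ⟨N', rfl⟩ : ∃ n, N = n + 1 := ⟨N - 1, by omega⟩
          rw [rp, List.append_assoc] at hkN
          have e1 : r <+: k := pre_of (List.IsPrefix.trans ⟨_, rfl⟩ (List.prefix_refl _))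
            (List.IsPrefix.trans ⟨_, rfl⟩ hkN) hge
          obtain ⟨k', rfl⟩ := e1
          rw [List.append_assoc, List.prefix_append_right_inj] at hkN
          obtain ⟨j, rfl⟩ := ih N' k' (by simp at hk; omega) hkN
          exact ⟨j + 1, rfl⟩
    exact no3_aligned hm1 hr hv hru (fun N k h => hal _ N k le_rfl h) h3

lemma dich_le {u v : List A} (huv : u ≠ v) (hl : u.length ≤ v.length)
    (h3 : MkEmbeddable u v 3) (k : ℕ) : MkEmbeddable u v k := by
  have key : ∀ u v : List A, u.length ≤ v.length → MkEmbeddable u v 3 → u <+: v := by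
    intro u v hl h3
    by_contra h
    apply no3_incomp h _ h3
    intro h'
    exact h (h'.eq_of_length (le_antisymm h'.length_le hl) ▸ List.prefix_refl _)
  have hs : u <:+ v := by
    rw [← List.reverse_prefix]
    exact key _ _ (by simpa using hl) (mk_rev h3)
  exact dich_bordered huv (key u v hl h3) hs h3 k

end helpers

/-- main dichotomy. For a one-rule SRS over a finite alphabet
with at least two letters and `u ≠ v`, `M_2` is embeddable in `G_S`, and
exactly one of the following holds: either `M_3` is not embeddable in `G_S`
(so `k = 2` is maximal), or `M_k` is embeddable in `G_S` for every `k ≥ 1`. -/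
theorem main_dichotomy {A : Type*} [Fintype A] (hA : 2 ≤ Fintype.card A)
    (u v : List A) (huv : u ≠ v) :
    MkEmbeddable u v 2 ∧
      Xor' (¬ MkEmbeddable u v 3)
        (∀ k : ℕ, 1 ≤ k → MkEmbeddable u v k) := by
  have hnt : Nontrivial A := Fintype.one_lt_card_iff_nontrivial.1 (by omega)
  refine ⟨m2_all (fun a => exists_ne a) u v huv, ?_⟩
  by_cases h3 : MkEmbeddable u v 3
  · refine Or.inr ⟨fun k _ => ?_, fun h => h h3⟩
    rcases Nat.le_total u.length v.length with h | h
    · exact dich_le huv h h3 k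
    · exact mk_swap (dich_le huv.symm h (mk_swap h3) k)
  · exact Or.inl ⟨h3, fun h => h3 (h 3 (by norm_num))⟩
end
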